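/- Let G be a group and let φ be an endomorphism of G such that, for some N ≥ 1, the restriction of φ to the image subgroup φ^N(G) is injective. Then φ maps the stable image φ^∞(G) = ⋂_{k ≥ 1} φ^k(G) into itself, the restriction φ_∞ : φ^∞(G) → φ^∞(G) is an automorphism (i.e., bijective), and Fix(φ) = Fix(φ_∞) ≤ φ^∞(G). -/

import Mathlib

/-- The fixed subgroup of an endomorphism. -/
def fixedSubgroup {G : Type*} [Group G] (φ : G →* G) : Subgroup G where
  carrier := {g | φ g = g}
  one_mem' := by simp
  mul_mem' := by
    intro a b ha hb
    simp only [Set.mem_setOf_eq, map_mul] at *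
    rw [ha, hb]
  inv_mem' := by
    intro a ha
    simp only [Set.mem_setOf_eq, map_inv] at *
    rw [ha]

/-- The `k`-th iterate of an endomorphism. -/
def iterHom {G : Type*} [Group G] (φ : G →* G) : ℕ → (G →* G)
  | 0 => MonoidHom.id G
  | k + 1 => φ.comp (iterHom φ k)

/-- The stable image `φ^∞(G) = ⋂_{k ≥ 1} φ^k(G)` of an endomorphism `φ`. -/
def stableImage {G : Type*} [Group G] (φ : G →* G) : Subgroup G :=
  ⨅ k : ℕ, (iterHom φ (k + 1)).range

theorem iterHom_apply {G : Type*} [Group G] (φ : G →* G) (k : ℕ) (x : G) :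
    iterHom φ k x = φ^[k] x := by
  induction k with
  | zero => rfl
  | succ k ih => rw [Function.iterate_succ_apply', ← ih]; rfl

theorem mem_range_iterHom {G : Type*} [Group G] {φ : G →* G} {k : ℕ} {x : G} :
    x ∈ (iterHom φ k).range ↔ ∃ y, φ^[k] y = x := by
  simp only [MonoidHom.mem_range, iterHom_apply]

theorem mem_stableImage {G : Type*} [Group G] {φ : G →* G} {x : G} :
    x ∈ stableImage φ ↔ ∀ k, ∃ y, φ^[k + 1] y = x := by
  simp only [stableImage, Subgroup.mem_iInf, mem_range_iterHom]

theorem map_mem_stableImage {G : Type*} [Group G] {φ : G →* G} {x : G}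
    (hx : x ∈ stableImage φ) : φ x ∈ stableImage φ := by
  rw [mem_stableImage] at hx ⊢
  intro k
  obtain ⟨y, rfl⟩ := hx k
  exact ⟨φ y, Function.Commute.iterate_self φ (k + 1) y⟩

theorem fixedSubgroup_le_stableImage {G : Type*} [Group G] (φ : G →* G) :
    fixedSubgroup φ ≤ stableImage φ :=
  fun x hx => mem_stableImage.2 fun k => ⟨x, Function.iterate_fixed hx (k + 1)⟩

theorem stableImage_le_range_iterHom {G : Type*} [Group G] (φ : G →* G) (k : ℕ) :
    stableImage φ ≤ (iterHom φ k).range := by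
  intro x hx
  obtain ⟨y, rfl⟩ := mem_stableImage.1 hx k
  exact mem_range_iterHom.2 ⟨φ y, rfl⟩

theorem exists_mem_stableImage_map_eq {G : Type*} [Group G] {φ : G →* G} {N : ℕ}
    (hinj : Set.InjOn φ (iterHom φ N).range) {x : G} (hx : x ∈ stableImage φ) :
    ∃ z ∈ stableImage φ, φ z = x := by
  obtain ⟨y, hy⟩ := mem_stableImage.1 hx N
  rw [Function.iterate_succ_apply'] at hy
  refine ⟨φ^[N] y, mem_stableImage.2 fun k => ?_, hy⟩
  obtain ⟨w, hw⟩ := mem_stableImage.1 hx (N + (k + 1))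
  rw [Function.iterate_succ_apply'] at hw
  refine ⟨φ^[N] w, ?_⟩
  rw [← Function.iterate_add_apply, Nat.add_comm]
  refine hinj (mem_range_iterHom.2 ⟨φ^[k + 1] w, ?_⟩) (mem_range_iterHom.2 ⟨y, rfl⟩)
    (hw.trans hy.symm)
  rw [← Function.iterate_add_apply]

/-- If the restriction of an endomorphism `φ` of `G` to the image `φ^N(G)` is injective for
some `N ≥ 1`, then `φ` maps the stable image `φ^∞(G)` into itself, the restriction
`φ_∞ : φ^∞(G) → φ^∞(G)` is an automorphism (bijective), and
`Fix(φ) = Fix(φ_∞) ≤ φ^∞(G)`. -/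
theorem stableImage_restriction_aut_of_eventually_injective (G : Type*) [Group G]
    (φ : G →* G) (N : ℕ) (hN : 1 ≤ N)
    (hinj : ∀ x ∈ (iterHom φ N).range, ∀ y ∈ (iterHom φ N).range, φ x = φ y → x = y) :
    (∀ x ∈ stableImage φ, φ x ∈ stableImage φ) ∧
    ∃ ψ : ↥(stableImage φ) →* ↥(stableImage φ),
      (∀ x : ↥(stableImage φ), (ψ x : G) = φ ↑x) ∧
      Function.Bijective ψ ∧
      fixedSubgroup φ ≤ stableImage φ ∧
      Subgroup.map (stableImage φ).subtype (fixedSubgroup ψ) = fixedSubgroup φ := by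
  refine ⟨fun x => map_mem_stableImage,
    (φ.comp (stableImage φ).subtype).codRestrict (stableImage φ)
      fun x => map_mem_stableImage x.2, fun _ => rfl, ⟨?_, ?_⟩,
    fixedSubgroup_le_stableImage φ, ?_⟩
  · intro x y hxy
    exact Subtype.ext (hinj x (stableImage_le_range_iterHom φ N x.2) y
      (stableImage_le_range_iterHom φ N y.2) (congrArg Subtype.val hxy))
  · intro x
    obtain ⟨z, hz, hzx⟩ := exists_mem_stableImage_map_eq
      (fun a ha b hb => hinj a ha b hb) x.2
    exact ⟨⟨z, hz⟩, Subtype.ext hzx⟩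
  · ext x
    constructor
    · rintro ⟨y, hy, rfl⟩
      exact congrArg Subtype.val hy
    · intro hx
      exact ⟨⟨x, fixedSubgroup_le_stableImage φ hx⟩, Subtype.ext hx, rfl⟩
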